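/- arXiv:2406.01856 — 6 statements merged into one kernel-verified Lean document; each statement's English description precedes it below -/
import Mathlib

section
/- Suppose the n-tuple (û_1,…,û_n) of unit vectors attains Val(RP-R). Then for every W ∈ 𝒲 one has Σ_{i<j} W_{ij}·arccos(⟨û_i,û_j⟩)/π ≥ 0.878·Val(RP). Moreover, for every y ∈ {−1,1}^n one has inf_{W ∈ 𝒲} (1/2)·Σ_{i<j} W_{ij}(1 − y_i y_j) ≤ Val(RP). -/
open Finset RealInnerProductSpace Real

/-- Inner (worst-case) objective evaluated at a ±1 vector `y`:
`(1/2) Σ_{i<j} W_{ij} (1 - y_i y_j)`. -/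
noncomputable def cutObjY (n : ℕ) (W : Matrix (Fin n) (Fin n) ℝ) (y : Fin n → ℝ) : ℝ :=
  (1 / 2) * ∑ i : Fin n, ∑ j ∈ Finset.univ.filter (fun j => i < j), W i j * (1 - y i * y j)

/-- Inner objective of the vector relaxation at a tuple of vectors `u`:
`(1/2) Σ_{i<j} W_{ij} (1 - ⟨u_i, u_j⟩)`. -/
noncomputable def cutObjU (n : ℕ) (W : Matrix (Fin n) (Fin n) ℝ)
    (u : Fin n → EuclideanSpace ℝ (Fin n)) : ℝ :=
  (1 / 2) * ∑ i : Fin n, ∑ j ∈ Finset.univ.filter (fun j => i < j), W i j * (1 - ⟪u i, u j⟫)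

/-- Expected weight of the Goemans–Williamson rounded cut of `(uhat_i)` evaluated at `W`:
`Σ_{i<j} W_{ij} arccos(⟨uhat_i, uhat_j⟩)/π`. -/
noncomputable def expCut (n : ℕ) (W : Matrix (Fin n) (Fin n) ℝ)
    (u : Fin n → EuclideanSpace ℝ (Fin n)) : ℝ :=
  ∑ i : Fin n, ∑ j ∈ Finset.univ.filter (fun j => i < j),
    W i j * (Real.arccos ⟪u i, u j⟫ / Real.pi)

/-- The robust max-cut value Val(RP). -/
noncomputable def valRP (n : ℕ) (𝒲 : Set (Matrix (Fin n) (Fin n) ℝ)) : ℝ :=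
  ⨆ y : {y : Fin n → ℝ // ∀ i, y i = 1 ∨ y i = -1}, ⨅ W : 𝒲, cutObjY n W y

/-- The fourth-order Taylor polynomial of the cosine bounds it from above. -/
lemma cos_le_taylor_four {x : ℝ} (hx : 0 ≤ x) : cos x ≤ 1 - x ^ 2 / 2 + x ^ 4 / 24 := by
  have hderiv (t : ℝ) : HasDerivAt (fun t => 1 - t ^ 2 / 2 + t ^ 4 / 24 - cos t)
      (sin t - (t - t ^ 3 / 6)) t := by
    refine (((((hasDerivAt_pow 2 t).div_const 2).const_sub 1).add
      ((hasDerivAt_pow 4 t).div_const 24)).sub (hasDerivAt_cos t)).congr_deriv ?_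
    push_cast
    ring
  have hmono : MonotoneOn (fun t => 1 - t ^ 2 / 2 + t ^ 4 / 24 - cos t) (Set.Ici 0) := by
    refine monotoneOn_of_deriv_nonneg (convex_Ici 0) (by fun_prop) (by fun_prop) fun t ht => ?_
    rw [interior_Ici] at ht
    rw [(hderiv t).deriv]
    exact sub_nonneg.2 (sin_ge_sub_cube (le_of_lt ht))
  have h := hmono Set.self_mem_Ici hx hx
  norm_num at h
  linarith

/-- The Goemans–Williamson inequality in angular form, `0.439 = 0.878 / 2`. -/
lemma mul_one_sub_cos_le {θ : ℝ} (h0 : 0 ≤ θ) (hπ : θ ≤ π) :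
    0.439 * π * (1 - cos θ) ≤ θ := by
  have hπ_gt : 3.1415 < π := pi_gt_d4
  have hπ_lt : π < 3.1416 := pi_lt_d4
  rcases le_total θ 1.445 with hθ | hθ
  · have hcos : 1 - cos θ ≤ θ ^ 2 / 2 := by linarith [one_sub_sq_div_two_le_cos (x := θ)]
    calc 0.439 * π * (1 - cos θ) ≤ 0.439 * 3.1416 * (θ ^ 2 / 2) := by
          gcongr
          linarith [cos_le_one θ]
      _ ≤ θ := by nlinarith
  · obtain ⟨φ, rfl⟩ : ∃ φ, θ = π - φ := ⟨π - θ, by ring⟩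
    have hφ0 : 0 ≤ φ := by linarith
    have hφ : φ ≤ 1.7 := by linarith
    rw [cos_pi_sub]
    have hfactor : 0 ≤ 12 - (φ ^ 2 + 2 * 0.8155 * φ + 3 * 0.8155 ^ 2) := by nlinarith
    have hsq := mul_nonneg (sq_nonneg (φ - 0.8155)) hfactor
    have hcoef : 0 ≤ 0.122 + 0.439 * (φ ^ 2 / 2 - φ ^ 4 / 24) := by
      nlinarith [mul_nonneg (sq_nonneg φ) (show 0 ≤ 12 - φ ^ 2 by nlinarith)]
    have hpoly : φ ≤ 3.1415 * (0.122 + 0.439 * (φ ^ 2 / 2 - φ ^ 4 / 24)) := by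
      nlinarith
    have hpoly_pi := hpoly.trans (mul_le_mul_of_nonneg_right hπ_gt.le hcoef)
    have hcos := mul_le_mul_of_nonneg_left (cos_le_taylor_four hφ0)
      (show 0 ≤ 0.439 * π by positivity)
    linarith

/-- The Goemans–Williamson inequality. -/
lemma mul_one_sub_le_arccos_div_pi {t : ℝ} (h1 : -1 ≤ t) (h2 : t ≤ 1) :
    0.878 * ((1 / 2) * (1 - t)) ≤ arccos t / π := by
  have h := mul_one_sub_cos_le (arccos_nonneg t) (arccos_le_pi t)
  rw [cos_arccos h1 h2] at h
  rw [le_div_iff₀ pi_pos]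
  linarith

lemma mul_cutObjU_le_expCut {n : ℕ} {W : Matrix (Fin n) (Fin n) ℝ} (hW : ∀ i j, 0 ≤ W i j)
    {u : Fin n → EuclideanSpace ℝ (Fin n)} (hu : ∀ i, ‖u i‖ = 1) :
    0.878 * cutObjU n W u ≤ expCut n W u := by
  unfold cutObjU expCut
  simp only [Finset.mul_sum]
  refine Finset.sum_le_sum fun i _ => Finset.sum_le_sum fun j _ => ?_
  have habs : |⟪u i, u j⟫| ≤ 1 := by
    simpa [hu] using abs_real_inner_le_norm (u i) (u j)
  obtain ⟨h1, h2⟩ := abs_le.1 habs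
  linarith [mul_le_mul_of_nonneg_left (mul_one_sub_le_arccos_div_pi h1 h2) (hW i j)]

/-- A sign vector embeds in the vector relaxation along a fixed coordinate axis. -/
lemma cutObjU_single {n : ℕ} (W : Matrix (Fin n) (Fin n) ℝ) (k : Fin n) (y : Fin n → ℝ) :
    cutObjU n W (fun i => EuclideanSpace.single k (y i)) = cutObjY n W y := by
  simp [cutObjU, cutObjY, EuclideanSpace.inner_single_left, mul_comm]

/-- If `(uhat_i)` attains Val(RP-R), then the expected rounded cut value is at least
`0.878 · Val(RP)` for every `W ∈ 𝒲`; moreover every ±1 vector's worst-case cut value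
is at most Val(RP). -/
theorem robust_maxcut_approx (n : ℕ) (hn : 1 ≤ n)
    (𝒲 : Set (Matrix (Fin n) (Fin n) ℝ)) (hne : 𝒲.Nonempty)
    (hsym : ∀ W ∈ 𝒲, W.IsSymm) (hnonneg : ∀ W ∈ 𝒲, ∀ i j, 0 ≤ W i j)
    (hbddY : ∀ y : Fin n → ℝ, BddBelow (Set.range fun W : 𝒲 => cutObjY n W y))
    (hbddU : ∀ u : Fin n → EuclideanSpace ℝ (Fin n),
      BddBelow (Set.range fun W : 𝒲 => cutObjU n W u))
    (hbddSupY : BddAbove (Set.range fun y : {y : Fin n → ℝ // ∀ i, y i = 1 ∨ y i = -1} =>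
      ⨅ W : 𝒲, cutObjY n W y))
    (hbddSupU : BddAbove
      (Set.range fun u : {u : Fin n → EuclideanSpace ℝ (Fin n) // ∀ i, ‖u i‖ = 1} =>
        ⨅ W : 𝒲, cutObjU n W u))
    (uhat : Fin n → EuclideanSpace ℝ (Fin n)) (huhat : ∀ i, ‖uhat i‖ = 1)
    (hatt : (⨅ W : 𝒲, cutObjU n W uhat)
      = ⨆ u : {u : Fin n → EuclideanSpace ℝ (Fin n) // ∀ i, ‖u i‖ = 1},
          ⨅ W : 𝒲, cutObjU n W u) :
    (∀ W ∈ 𝒲, expCut n W uhat ≥ 0.878 * valRP n 𝒲) ∧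
    (∀ y : Fin n → ℝ, (∀ i, y i = 1 ∨ y i = -1) →
      (⨅ W : 𝒲, cutObjY n W y) ≤ valRP n 𝒲) := by
  have hvalY (y : Fin n → ℝ) (hy : ∀ i, y i = 1 ∨ y i = -1) :
      (⨅ W : 𝒲, cutObjY n W y) ≤ valRP n 𝒲 := le_ciSup hbddSupY ⟨y, hy⟩
  refine ⟨fun W hW => ?_, hvalY⟩
  have hrelax : valRP n 𝒲 ≤ ⨅ W : 𝒲, cutObjU n W uhat := by
    rw [hatt]
    have : Nonempty {y : Fin n → ℝ // ∀ i, y i = 1 ∨ y i = -1} := ⟨fun _ => 1, by simp⟩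
    refine ciSup_le fun ⟨y, hy⟩ => ?_
    have hunit (i : Fin n) : ‖EuclideanSpace.single (⟨0, hn⟩ : Fin n) (y i)‖ = 1 := by
      rcases hy i with h | h <;> simp [h]
    simpa only [cutObjU_single] using le_ciSup hbddSupU ⟨_, hunit⟩
  have hinf : (⨅ W : 𝒲, cutObjU n W uhat) ≤ cutObjU n W uhat := ciInf_le (hbddU uhat) ⟨W, hW⟩
  linarith [mul_cutObjU_le_expCut (hnonneg W hW) huhat]
end

section
/- Suppose the n-tuple (û_1,…,û_n) of unit vectors attains Val(DRP-R). Then for every P ∈ 𝒫₊ one has Σ_{i<j} (∫ W_{ij} dP(W))·arccos(⟨û_i,û_j⟩)/π ≥ 0.878·Val(DRP). Moreover, for every y ∈ {−1,1}^n one has inf_{P ∈ 𝒫₊} (1/2)·Σ_{i<j} (∫ W_{ij} dP(W))·(1 − y_i y_j) ≤ Val(DRP). -/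
open Finset RealInnerProductSpace MeasureTheory

/-- Inner (worst-case expected) objective at a ±1 vector `y`, for a distribution `P`
on weight matrices (encoded as functions `Fin n → Fin n → ℝ`):
`(1/2) Σ_{i<j} (∫ W_{ij} dP) (1 - y_i y_j)`. -/
noncomputable def droObjY (n : ℕ) (P : Measure (Fin n → Fin n → ℝ)) (y : Fin n → ℝ) : ℝ :=
  (1 / 2) * ∑ i : Fin n, ∑ j ∈ Finset.univ.filter (fun j => i < j),
    (∫ W, W i j ∂P) * (1 - y i * y j)

/-- Inner objective of the vector relaxation at a tuple of vectors `u`: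
`(1/2) Σ_{i<j} (∫ W_{ij} dP) (1 - ⟨u_i, u_j⟩)`. -/
noncomputable def droObjU (n : ℕ) (P : Measure (Fin n → Fin n → ℝ))
    (u : Fin n → EuclideanSpace ℝ (Fin n)) : ℝ :=
  (1 / 2) * ∑ i : Fin n, ∑ j ∈ Finset.univ.filter (fun j => i < j),
    (∫ W, W i j ∂P) * (1 - ⟪u i, u j⟫)

/-- Expected weight (under `P`, with an independent random hyperplane) of the rounded
cut of `(û_i)`: `Σ_{i<j} (∫ W_{ij} dP) arccos(⟨û_i, û_j⟩)/π`. -/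
noncomputable def droExpCut (n : ℕ) (P : Measure (Fin n → Fin n → ℝ))
    (u : Fin n → EuclideanSpace ℝ (Fin n)) : ℝ :=
  ∑ i : Fin n, ∑ j ∈ Finset.univ.filter (fun j => i < j),
    (∫ W, W i j ∂P) * (Real.arccos ⟪u i, u j⟫ / Real.pi)

/-- The distributionally robust max-cut value Val(DRP). -/
noncomputable def valDRP (n : ℕ) (𝒜 : Set (Measure (Fin n → Fin n → ℝ))) : ℝ :=
  ⨆ y : {y : Fin n → ℝ // ∀ i, y i = 1 ∨ y i = -1}, ⨅ P : 𝒜, droObjY n P y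

/-- Scalar form of the Goemans–Williamson bound: `0.439 π (1 - cos θ) ≤ θ` on `[0, π]`, proved by
expanding the cosine at `3π/4`. -/
theorem mul_one_sub_cos_le_angle {θ : ℝ} (h0 : 0 ≤ θ) (hpi : θ ≤ Real.pi) :
    0.439 * Real.pi * (1 - Real.cos θ) ≤ θ := by
  have hp1 := Real.pi_gt_d4
  have hp2 := Real.pi_lt_d4
  rcases le_total θ 1.4 with hθ | hθ
  · have hcos := Real.one_sub_sq_div_two_le_cos (x := θ)
    have hquad : 0.439 * Real.pi * (1 - Real.cos θ) ≤ 1.3792 * (θ ^ 2 / 2) :=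
      mul_le_mul (by linarith) (by linarith) (by linarith [Real.cos_le_one θ]) (by norm_num)
    nlinarith
  · obtain ⟨φ, rfl⟩ : ∃ φ, θ = Real.pi - Real.pi / 4 - φ := ⟨Real.pi - Real.pi / 4 - θ, by ring⟩
    have hs : √2 ^ 2 = 2 := Real.sq_sqrt (by norm_num)
    have hs0 := Real.sqrt_nonneg 2
    have hs1 : 1.4142 < √2 := by nlinarith
    have hs2 : √2 < 1.41422 := by nlinarith
    have hcos : 1 - Real.cos (Real.pi - Real.pi / 4 - φ)
        = 1 + √2 / 2 * (Real.cos φ - Real.sin φ) := by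
      rw [show Real.pi - Real.pi / 4 - φ = Real.pi - (Real.pi / 4 + φ) by ring,
        Real.cos_pi_sub, Real.cos_add, Real.cos_pi_div_four, Real.sin_pi_div_four]
      ring
    rw [hcos]
    have hc0 : 0 ≤ 0.439 * Real.pi * (√2 / 2) := by positivity
    have hc1 : 0.9750 ≤ 0.439 * Real.pi * (√2 / 2) := by nlinarith
    have hc2 : 0.439 * Real.pi * (√2 / 2) ≤ 0.97525 := by nlinarith
    rcases le_or_gt φ 0 with hφ | hφ
    · have hsin := Real.le_sin hφ
      have := mul_le_mul_of_nonneg_left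
        (show Real.cos φ - Real.sin φ ≤ 1 - φ by linarith [Real.cos_le_one φ]) hc0
      nlinarith
    · have hφ1 : φ ≤ 1 := by linarith
      have hsin := Real.sin_gt_sub_cube hφ
      have hcosφ := (abs_le.1 (Real.cos_bound (abs_le.2 ⟨by linarith, hφ1⟩))).2
      rw [abs_of_pos hφ] at hcosφ
      have h3 : φ ^ 3 ≤ φ ^ 2 := pow_le_pow_of_le_one hφ.le hφ1 (by norm_num)
      have h4 : φ ^ 4 ≤ φ ^ 2 := pow_le_pow_of_le_one hφ.le hφ1 (by norm_num)
      have := mul_le_mul_of_nonneg_left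
        (show Real.cos φ - Real.sin φ ≤ 1 - φ - 0.19 * φ ^ 2 by linarith [sq_nonneg φ]) hc0
      nlinarith [mul_le_mul_of_nonneg_right hc1 (sq_nonneg φ),
        mul_le_mul_of_nonneg_right hc1 hφ.le, sq_nonneg (φ - 0.067)]

theorem mul_one_sub_le_arccos_div_pi_s5 {x : ℝ} (h₁ : -1 ≤ x) (h₂ : x ≤ 1) :
    0.878 * (1 / 2 * (1 - x)) ≤ Real.arccos x / Real.pi := by
  have h := mul_one_sub_cos_le_angle (Real.arccos_nonneg x) (Real.arccos_le_pi x)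
  rw [Real.cos_arccos h₁ h₂] at h
  rw [le_div_iff₀ Real.pi_pos]
  linarith

/-- Every rounding of unit vectors by a random hyperplane recovers at least a `0.878` fraction
of the relaxed objective, for nonnegative expected weights. -/
theorem droObjU_le_droExpCut {n : ℕ} {P : Measure (Fin n → Fin n → ℝ)}
    (hP : ∀ i j, 0 ≤ ∫ W, W i j ∂P) {u : Fin n → EuclideanSpace ℝ (Fin n)}
    (hu : ∀ i, ‖u i‖ = 1) : 0.878 * droObjU n P u ≤ droExpCut n P u := by
  unfold droObjU droExpCut
  simp only [Finset.mul_sum]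
  refine Finset.sum_le_sum fun i _ => Finset.sum_le_sum fun j _ => ?_
  have habs := abs_le.1 (abs_real_inner_le_norm (u i) (u j))
  rw [hu i, hu j, mul_one] at habs
  have h := mul_le_mul_of_nonneg_left (mul_one_sub_le_arccos_div_pi_s5 habs.1 habs.2) (hP i j)
  linarith

/-- The vector tuple `y i • e` has the same objective as the sign vector `y`, for a unit `e`. -/
theorem droObjU_smul {n : ℕ} (P : Measure (Fin n → Fin n → ℝ)) (y : Fin n → ℝ)
    {e : EuclideanSpace ℝ (Fin n)} (he : ‖e‖ = 1) :
    droObjU n P (fun i => y i • e) = droObjY n P y := by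
  have hinner : ∀ i j, ⟪y i • e, y j • e⟫ = y i * y j := fun i j => by
    simp [real_inner_smul_left, real_inner_smul_right, he, mul_comm]
  simp only [droObjU, droObjY, hinner]

/-- If `(û_i)` attains Val(DRP-R), then the expected rounded cut value is at least
`0.878 · Val(DRP)` for every `P ∈ 𝒜`; moreover every ±1 vector's worst-case expected
cut value is at most Val(DRP). -/
theorem dro_maxcut_approx (n : ℕ) (hn : 1 ≤ n)
    (𝒜 : Set (Measure (Fin n → Fin n → ℝ))) (hne : 𝒜.Nonempty)
    (hprob : ∀ P ∈ 𝒜, IsProbabilityMeasure P)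
    (hsupp : ∀ P ∈ 𝒜, ∀ᵐ W ∂P, ∀ i j, W i j = W j i ∧ 0 ≤ W i j)
    (hint : ∀ P ∈ 𝒜, ∀ i j, Integrable (fun W => W i j) P)
    (hbddY : ∀ y : Fin n → ℝ, BddBelow (Set.range fun P : 𝒜 => droObjY n P y))
    (hbddU : ∀ u : Fin n → EuclideanSpace ℝ (Fin n),
      BddBelow (Set.range fun P : 𝒜 => droObjU n P u))
    (hbddSupY : BddAbove (Set.range fun y : {y : Fin n → ℝ // ∀ i, y i = 1 ∨ y i = -1} =>
      ⨅ P : 𝒜, droObjY n P y))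
    (hbddSupU : BddAbove
      (Set.range fun u : {u : Fin n → EuclideanSpace ℝ (Fin n) // ∀ i, ‖u i‖ = 1} =>
        ⨅ P : 𝒜, droObjU n P u))
    (uhat : Fin n → EuclideanSpace ℝ (Fin n)) (huhat : ∀ i, ‖uhat i‖ = 1)
    (hatt : (⨅ P : 𝒜, droObjU n P uhat)
      = ⨆ u : {u : Fin n → EuclideanSpace ℝ (Fin n) // ∀ i, ‖u i‖ = 1},
          ⨅ P : 𝒜, droObjU n P u) :
    (∀ P ∈ 𝒜, droExpCut n P uhat ≥ 0.878 * valDRP n 𝒜) ∧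
    (∀ y : Fin n → ℝ, (∀ i, y i = 1 ∨ y i = -1) →
      (⨅ P : 𝒜, droObjY n P y) ≤ valDRP n 𝒜) := by
  have hsign : ∀ y : Fin n → ℝ, (∀ i, y i = 1 ∨ y i = -1) →
      (⨅ P : 𝒜, droObjY n P y) ≤ valDRP n 𝒜 := fun y hy => le_ciSup hbddSupY ⟨y, hy⟩
  refine ⟨fun P hP => ?_, hsign⟩
  have hrelax : valDRP n 𝒜 ≤ ⨅ P : 𝒜, droObjU n P uhat := by
    rw [hatt]
    have : Nonempty {y : Fin n → ℝ // ∀ i, y i = 1 ∨ y i = -1} := ⟨⟨1, fun _ => Or.inl rfl⟩⟩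
    refine ciSup_le fun y => ?_
    obtain ⟨e, he⟩ : ∃ e : EuclideanSpace ℝ (Fin n), ‖e‖ = 1 :=
      ⟨EuclideanSpace.single ⟨0, hn⟩ 1, by simp⟩
    have hunit : ∀ i, ‖y.1 i • e‖ = 1 := fun i => by
      rcases y.2 i with h | h <;> simp [h, he]
    calc (⨅ P : 𝒜, droObjY n P y) = ⨅ P : 𝒜, droObjU n P fun i => y.1 i • e := by
          simp only [droObjU_smul _ _ he]
      _ ≤ _ := le_ciSup hbddSupU ⟨fun i => y.1 i • e, hunit⟩
  have hle : (⨅ P : 𝒜, droObjU n P uhat) ≤ droObjU n P uhat := ciInf_le (hbddU uhat) ⟨P, hP⟩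
  have hnonneg : ∀ i j, 0 ≤ ∫ W, W i j ∂P := fun i j =>
    integral_nonneg_of_ae ((hsupp P hP).mono fun W hW => (hW i j).2)
  linarith [droObjU_le_droExpCut hnonneg huhat]
end

section
/- Let n ≥ 2, let σ be the uniform (normalized rotation-invariant) probability measure on the unit sphere of ℝ^n, and let u, v be unit vectors in ℝ^n. Then σ({r on the unit sphere : sgn(⟨u,r⟩) ≠ sgn(⟨v,r⟩)}) = arccos(⟨u,v⟩)/π, where sgn(t) = 1 if t ≥ 0 and sgn(t) = −1 if t < 0. -/
open RealInnerProductSpace MeasureTheory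

/-- The sign function used in Goemans–Williamson rounding: `1` if `t ≥ 0`, `-1` otherwise. -/
noncomputable def gwSgn (t : ℝ) : ℝ := if 0 ≤ t then 1 else -1

open Real in
/-- In one half period, the cosine and its translate by `α ∈ [0, π]` have opposite signs exactly
on an interval of length `α`. -/
lemma setOf_cos_mul_cos_add_neg_inter_Ioc {α : ℝ} (h0 : 0 ≤ α) (hπ : α ≤ π) :
    {θ : ℝ | cos θ * cos (θ + α) < 0} ∩ Set.Ioc (-(π / 2)) (-(π / 2) + π)
      = Set.Ioo (π / 2 - α) (π / 2) := by
  ext θ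
  simp only [Set.mem_inter_iff, Set.mem_ofPred_eq, Set.mem_Ioc, Set.mem_Ioo]
  constructor
  · rintro ⟨h, h1, h2⟩
    have hlt : θ < π / 2 := by
      refine lt_of_le_of_ne (by linarith) ?_
      rintro rfl
      simp at h
    refine ⟨?_, hlt⟩
    by_contra! hc
    have hc1 : 0 ≤ cos θ := cos_nonneg_of_mem_Icc ⟨by linarith, by linarith⟩
    have hc2 : 0 ≤ cos (θ + α) := cos_nonneg_of_mem_Icc ⟨by linarith, by linarith⟩
    exact absurd h (not_lt.2 (mul_nonneg hc1 hc2))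
  · rintro ⟨h1, h2⟩
    refine ⟨mul_neg_of_pos_of_neg ?_ ?_, by linarith, by linarith⟩
    · exact cos_pos_of_mem_Ioo ⟨by linarith, by linarith⟩
    · exact cos_neg_of_pi_div_two_lt_of_lt (by linarith) (by linarith)

open Real in
lemma volume_setOf_cos_mul_cos_add_neg {α : ℝ} (h0 : 0 ≤ α) (hπ : α ≤ π) (a : ℝ) :
    volume ({θ : ℝ | cos θ * cos (θ + α) < 0} ∩ Set.Ioc a (a + π)) = ENNReal.ofReal α := by
  have hmeas : MeasurableSet {θ : ℝ | cos θ * cos (θ + α) < 0} :=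
    (isOpen_lt (by fun_prop) continuous_const).measurableSet
  have hper : Function.Periodic (fun θ : ℝ ↦ cos θ * cos (θ + α)) π := by
    intro θ
    simp only [add_right_comm θ π α, cos_add_pi, neg_mul_neg]
  have hinv : ∀ g : AddSubgroup.zmultiples π,
      (fun x : ℝ ↦ g +ᵥ x) ⁻¹' {θ : ℝ | cos θ * cos (θ + α) < 0}
        = {θ : ℝ | cos θ * cos (θ + α) < 0} := by
    rintro ⟨_, k, rfl⟩
    ext θ
    have hk : cos (k • π + θ) * cos (k • π + θ + α) = cos θ * cos (θ + α) := by
      rw [add_comm (k • π)]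
      exact hper.zsmul k θ
    change cos (k • π + θ) * cos (k • π + θ + α) < 0 ↔ cos θ * cos (θ + α) < 0
    rw [hk]
  rw [(isAddFundamentalDomain_Ioc pi_pos a volume).measure_set_eq
    (isAddFundamentalDomain_Ioc pi_pos (-(π / 2)) volume) hmeas hinv,
    setOf_cos_mul_cos_add_neg_inter_Ioc h0 hπ, volume_Ioo]
  congr 1
  ring

open Real in
/-- The same count of angles for an arbitrary nonzero sinusoid `x cos θ + y sin θ`. -/
lemma volume_setOf_sinusoid_mul_neg {α : ℝ} (h0 : 0 ≤ α) (hπ : α ≤ π) {x y : ℝ}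
    (hxy : x ≠ 0 ∨ y ≠ 0) :
    volume ({θ : ℝ | (cos θ * x + sin θ * y) * (cos (θ + α) * x + sin (θ + α) * y) < 0}
      ∩ Set.Ioc 0 π) = ENNReal.ofReal α := by
  set z : ℂ := ⟨x, y⟩
  have hz : 0 < ‖z‖ := by
    rw [norm_pos_iff]
    intro h
    rcases hxy with hx | hy
    · exact hx (congrArg Complex.re h)
    · exact hy (congrArg Complex.im h)
  have hx : x = ‖z‖ * cos z.arg := (Complex.norm_mul_cos_arg z).symm
  have hy : y = ‖z‖ * sin z.arg := (Complex.norm_mul_sin_arg z).symm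
  have hcomb : ∀ θ : ℝ, cos θ * x + sin θ * y = ‖z‖ * cos (θ + -z.arg) := by
    intro θ
    rw [← sub_eq_add_neg, cos_sub]
    linear_combination cos θ * hx + sin θ * hy
  rw [← volume_setOf_cos_mul_cos_add_neg h0 hπ (-z.arg),
    ← measure_preimage_add_right volume (-z.arg) (_ ∩ Set.Ioc (-z.arg) (-z.arg + π))]
  congr 1
  ext θ
  simp only [hcomb, Set.mem_inter_iff, Set.mem_ofPred_eq, Set.mem_Ioc, Set.mem_preimage]
  have h1 : ‖z‖ * cos (θ + -z.arg) * (‖z‖ * cos (θ + α + -z.arg))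
      = ‖z‖ ^ 2 * (cos (θ + -z.arg) * cos (θ + -z.arg + α)) := by
    rw [add_right_comm θ α]
    ring
  rw [h1, mul_neg_iff]
  have h2 : 0 < ‖z‖ ^ 2 := by positivity
  constructor
  · rintro ⟨h | h, h3, h4⟩
    · exact ⟨h.2, by linarith, by linarith⟩
    · exact absurd h.1 h2.le.not_gt
  · rintro ⟨h, h3, h4⟩
    exact ⟨.inl ⟨h2, h⟩, by linarith, by linarith⟩

section Isometry

variable {n : ℕ}

/-- In dimension at least two, every vector is orthogonal to some unit vector. -/
lemma exists_unit_vector_orthogonal (hn : 2 ≤ n) (u : EuclideanSpace ℝ (Fin n)) :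
    ∃ e : EuclideanSpace ℝ (Fin n), ‖e‖ = 1 ∧ ⟪u, e⟫ = 0 := by
  have hlt : Module.finrank ℝ (ℝ ∙ u) < Module.finrank ℝ (EuclideanSpace ℝ (Fin n)) := by
    have := finrank_span_le_card (R := ℝ) {u}
    rw [finrank_euclideanSpace_fin]
    simp only [Set.toFinset_singleton, Finset.card_singleton] at this
    omega
  have hne : (ℝ ∙ u)ᗮ ≠ ⊥ := by
    intro h
    rw [Submodule.orthogonal_eq_bot_iff] at h
    rw [h, finrank_top] at hlt
    exact lt_irrefl _ hlt
  obtain ⟨w, hw, hw0⟩ := Submodule.exists_mem_ne_zero_of_ne_bot hne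
  refine ⟨‖w‖⁻¹ • w, norm_smul_inv_norm hw0, ?_⟩
  rw [inner_smul_right, Submodule.mem_orthogonal_singleton_iff_inner_right.1 hw, mul_zero]

/-- Any two orthonormal pairs are related by a linear isometry. -/
lemma exists_linearIsometryEquiv_pair (hn : 2 ≤ n) {e f e' f' : EuclideanSpace ℝ (Fin n)}
    (he : ‖e‖ = 1) (hf : ‖f‖ = 1) (hef : ⟪e, f⟫ = 0)
    (he' : ‖e'‖ = 1) (hf' : ‖f'‖ = 1) (hef' : ⟪e', f'⟫ = 0) :
    ∃ O : EuclideanSpace ℝ (Fin n) ≃ₗᵢ[ℝ] EuclideanSpace ℝ (Fin n), O e = e' ∧ O f = f' := by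
  let i0 : Fin n := ⟨0, by omega⟩
  let i1 : Fin n := ⟨1, by omega⟩
  have h01 : i1 ≠ i0 := by simp [i0, i1]
  have key : ∀ a b : EuclideanSpace ℝ (Fin n), ‖a‖ = 1 → ‖b‖ = 1 → ⟪a, b⟫ = 0 →
      ∃ B : OrthonormalBasis (Fin n) ℝ (EuclideanSpace ℝ (Fin n)), B i0 = a ∧ B i1 = b := by
    intro a b ha hb hab
    let w : Fin n → EuclideanSpace ℝ (Fin n) := fun i ↦ if i = i0 then a else b
    have hw : Orthonormal ℝ (({i0, i1} : Set (Fin n)).domRestrict w) := by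
      constructor
      · rintro ⟨i, rfl | rfl⟩ <;> simp [Set.domRestrict, w, h01, ha, hb]
      · rintro ⟨i, rfl | rfl⟩ ⟨j, rfl | rfl⟩ hij <;>
          simp_all [Set.domRestrict, w, real_inner_comm]
    obtain ⟨B, hB⟩ := hw.exists_orthonormalBasis_extension_of_card_eq (by simp)
    refine ⟨B, ?_, ?_⟩
    · simpa [w] using hB i0 (by simp)
    · simpa [w, h01] using hB i1 (by simp)
  obtain ⟨B, rfl, rfl⟩ := key e f he hf hef
  obtain ⟨B', rfl, rfl⟩ := key e' f' he' hf' hef'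
  exact ⟨B.equiv B' (Equiv.refl _), by simp, by simp⟩

/-- Any two unit vectors are related by a linear isometry. -/
lemma exists_linearIsometryEquiv_apply_eq (hn : 2 ≤ n) {u v : EuclideanSpace ℝ (Fin n)}
    (hu : ‖u‖ = 1) (hv : ‖v‖ = 1) :
    ∃ O : EuclideanSpace ℝ (Fin n) ≃ₗᵢ[ℝ] EuclideanSpace ℝ (Fin n), O u = v := by
  obtain ⟨e, he, hue⟩ := exists_unit_vector_orthogonal hn u
  obtain ⟨f, hf, hvf⟩ := exists_unit_vector_orthogonal hn v
  obtain ⟨O, hO, -⟩ := exists_linearIsometryEquiv_pair hn hu he hue hv hf hvf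
  exact ⟨O, hO⟩

/-- In a suitable oriented plane containing `u`, the unit vector at angle `arccos ⟪u, v⟫` from `u`
is `v`. -/
lemma exists_orthonormal_decomposition (hn : 2 ≤ n) {u v : EuclideanSpace ℝ (Fin n)}
    (hu : ‖u‖ = 1) (hv : ‖v‖ = 1) :
    ∃ e : EuclideanSpace ℝ (Fin n), ‖e‖ = 1 ∧ ⟪u, e⟫ = 0 ∧
      v = Real.cos (Real.arccos ⟪u, v⟫) • u + Real.sin (Real.arccos ⟪u, v⟫) • e := by
  have habs : |⟪u, v⟫| ≤ 1 := by simpa [hu, hv] using abs_real_inner_le_norm u v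
  obtain ⟨hl, hr⟩ := abs_le.1 habs
  rw [Real.cos_arccos hl hr]
  have huu : ⟪u, u⟫ = 1 := by rw [real_inner_self_eq_norm_sq, hu, one_pow]
  set s := Real.sin (Real.arccos ⟪u, v⟫) with hs
  have hs0 : 0 ≤ s := Real.sin_nonneg_of_nonneg_of_le_pi (Real.arccos_nonneg _)
    (Real.arccos_le_pi _)
  have hsq : s ^ 2 = 1 - ⟪u, v⟫ ^ 2 := by
    rw [hs, Real.sin_arccos, Real.sq_sqrt]
    nlinarith [sq_abs ⟪u, v⟫, abs_nonneg ⟪u, v⟫]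
  have hw : ‖v - ⟪u, v⟫ • u‖ = s := by
    rw [← sq_eq_sq₀ (norm_nonneg _) hs0, hsq, norm_sub_sq_real, norm_smul, inner_smul_right,
      real_inner_comm u v, hu, hv, Real.norm_eq_abs, mul_one, sq_abs]
    ring
  have horth : ⟪u, v - ⟪u, v⟫ • u⟫ = 0 := by
    rw [inner_sub_right, inner_smul_right, huu, mul_one, sub_self]
  rcases hs0.eq_or_lt with h | h
  · obtain ⟨e, he, hue⟩ := exists_unit_vector_orthogonal hn u
    refine ⟨e, he, hue, ?_⟩
    rw [← h, norm_eq_zero, sub_eq_zero] at hw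
    rw [← h, zero_smul, add_zero]
    exact hw
  · refine ⟨s⁻¹ • (v - ⟪u, v⟫ • u), ?_, ?_, ?_⟩
    · rw [norm_smul, hw, norm_inv, Real.norm_of_nonneg hs0, inv_mul_cancel₀ h.ne']
    · rw [inner_smul_right, horth, mul_zero]
    · rw [smul_inv_smul₀ h.ne', add_sub_cancel]

end Isometry

section InvariantMeasure

variable {n : ℕ} {σ : Measure (EuclideanSpace ℝ (Fin n))}

lemma measure_preimage_linearIsometryEquiv
    (hσinv : ∀ O : EuclideanSpace ℝ (Fin n) ≃ₗᵢ[ℝ] EuclideanSpace ℝ (Fin n), σ.map O = σ)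
    (O : EuclideanSpace ℝ (Fin n) ≃ₗᵢ[ℝ] EuclideanSpace ℝ (Fin n))
    (s : Set (EuclideanSpace ℝ (Fin n))) : σ (O ⁻¹' s) = σ s := by
  conv_rhs => rw [← hσinv O]
  exact (O.toHomeomorph.toMeasurableEquiv.map_apply s).symm

/-- A rotation-invariant probability measure without mass at the origin does not charge
linear hyperplanes. -/
lemma measure_hyperplane_eq_zero (hn : 2 ≤ n) [IsProbabilityMeasure σ] (h0 : σ {0} = 0)
    (hσinv : ∀ O : EuclideanSpace ℝ (Fin n) ≃ₗᵢ[ℝ] EuclideanSpace ℝ (Fin n), σ.map O = σ)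
    {u : EuclideanSpace ℝ (Fin n)} (hu : ‖u‖ = 1) : σ {r | ⟪u, r⟫ = 0} = 0 := by
  have hunit : ∀ w : EuclideanSpace ℝ (Fin n), w ≠ 0 →
      σ {r | ⟪w, r⟫ = 0} = σ {r | ⟪u, r⟫ = 0} := by
    intro w hw
    obtain ⟨O, hO⟩ := exists_linearIsometryEquiv_apply_eq hn hu
      (norm_smul_inv_norm (𝕜 := ℝ) hw)
    rw [← measure_preimage_linearIsometryEquiv hσinv O {r | ⟪w, r⟫ = 0}]
    congr 1
    ext r
    have hOw : w = ‖w‖ • O u := by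
      rw [hO]
      exact (smul_inv_smul₀ (norm_ne_zero_iff.2 hw) w).symm
    simp only [Set.mem_preimage, Set.mem_ofPred_eq]
    rw [hOw, real_inner_smul_left, O.inner_map_map]
    simp [hw]
  let T : Set (EuclideanSpace ℝ (Fin n) × EuclideanSpace ℝ (Fin n)) := {p | ⟪p.1, p.2⟫ = 0}
  have hT : MeasurableSet T :=
    (isClosed_eq (by fun_prop) continuous_const).measurableSet
  have hTzero : (volume.prod σ) T = 0 := by
    rw [Measure.prod_apply_symm hT, lintegral_eq_zero_iff (measurable_measure_prodMk_right hT)]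
    have hne : ∀ᵐ r ∂σ, r ≠ 0 := by
      rw [ae_iff]
      simpa using h0
    filter_upwards [hne] with r hr
    have hset : (fun w ↦ (w, r)) ⁻¹' T = ((ℝ ∙ r)ᗮ : Submodule ℝ _) := by
      ext w
      simp only [T, Set.mem_preimage, Set.mem_ofPred_eq, SetLike.mem_coe,
        Submodule.mem_orthogonal_singleton_iff_inner_left]
    rw [hset]
    refine Measure.addHaar_submodule _ _ ?_
    rw [Ne, Submodule.orthogonal_eq_top_iff, Submodule.span_singleton_eq_bot]
    exact hr
  have hae := Measure.measure_ae_null_of_prod_null hTzero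
  have : Nontrivial (EuclideanSpace ℝ (Fin n)) := ⟨u, 0, by rintro rfl; simp at hu⟩
  have hw : ∀ᵐ w : EuclideanSpace ℝ (Fin n), w ≠ 0 := by
    rw [ae_iff]
    simp
  obtain ⟨w, hw1, hw2⟩ := (hae.and hw).exists
  rw [← hunit w hw2]
  exact hw1

/-- The measure of the double wedge on which two linear forms have opposite signs. -/
lemma measure_inner_mul_inner_neg (hn : 2 ≤ n) [IsProbabilityMeasure σ] (h0 : σ {0} = 0)
    (hσinv : ∀ O : EuclideanSpace ℝ (Fin n) ≃ₗᵢ[ℝ] EuclideanSpace ℝ (Fin n), σ.map O = σ)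
    {u v : EuclideanSpace ℝ (Fin n)} (hu : ‖u‖ = 1) (hv : ‖v‖ = 1) :
    σ {r | ⟪u, r⟫ * ⟪v, r⟫ < 0} = ENNReal.ofReal (Real.arccos ⟪u, v⟫ / Real.pi) := by
  obtain ⟨e, he, hue, hve⟩ := exists_orthonormal_decomposition hn hu hv
  set α := Real.arccos ⟪u, v⟫
  have hα0 : 0 ≤ α := Real.arccos_nonneg _
  have hαπ : α ≤ Real.pi := Real.arccos_le_pi _
  let c : ℝ → EuclideanSpace ℝ (Fin n) := fun θ ↦ Real.cos θ • u + Real.sin θ • e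
  have hc : Continuous c := by fun_prop
  let T : Set (ℝ × EuclideanSpace ℝ (Fin n)) := {p | ⟪c p.1, p.2⟫ * ⟪c (p.1 + α), p.2⟫ < 0}
  have hT : MeasurableSet T := (isOpen_lt (by fun_prop) continuous_const).measurableSet
  have hrot : ∀ θ, σ (Prod.mk θ ⁻¹' T) = σ {r | ⟪u, r⟫ * ⟪v, r⟫ < 0} := by
    intro θ
    have heu : ⟪e, u⟫ = 0 := by rw [real_inner_comm, hue]
    have huu : ⟪u, u⟫ = 1 := by rw [real_inner_self_eq_norm_sq, hu, one_pow]
    have hee : ⟪e, e⟫ = 1 := by rw [real_inner_self_eq_norm_sq, he, one_pow]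
    have hnorm : ∀ x y : ℝ, x ^ 2 + y ^ 2 = 1 → ‖x • u + y • e‖ = 1 := by
      intro x y hxy
      rw [← sq_eq_sq₀ (norm_nonneg _) zero_le_one, ← real_inner_self_eq_norm_sq]
      simp only [inner_add_left, inner_add_right, real_inner_smul_left, inner_smul_right,
        heu, hue, huu, hee]
      linear_combination hxy
    obtain ⟨O, hOu, hOe⟩ := exists_linearIsometryEquiv_pair hn hu he hue
      (e' := c θ) (f' := (-Real.sin θ) • u + Real.cos θ • e)
      (hnorm _ _ (Real.cos_sq_add_sin_sq θ))
      (hnorm _ _ (by rw [neg_sq]; exact Real.sin_sq_add_cos_sq θ))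
      (by
        simp only [c, inner_add_left, inner_add_right, real_inner_smul_left, inner_smul_right,
          heu, hue, huu, hee]
        ring)
    have hOv : O v = c (θ + α) := by
      conv_lhs => rw [hve]
      simp only [map_add, map_smul, hOu, hOe, c, Real.cos_add, Real.sin_add]
      module
    rw [← measure_preimage_linearIsometryEquiv hσinv O]
    congr 1
    ext r
    simp only [T, Set.mem_preimage, Set.mem_ofPred_eq, ← hOu, ← hOv, O.inner_map_map]
  have hfib : ∀ᵐ r ∂σ, (volume.restrict (Set.Ioc 0 Real.pi)) ((fun θ ↦ (θ, r)) ⁻¹' T)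
      = ENNReal.ofReal α := by
    have hne : ∀ᵐ r ∂σ, ⟪u, r⟫ ≠ 0 := by
      rw [ae_iff]
      simpa using measure_hyperplane_eq_zero hn h0 hσinv hu
    filter_upwards [hne] with r hr
    rw [Measure.restrict_apply (measurable_prodMk_right hT),
      ← volume_setOf_sinusoid_mul_neg hα0 hαπ (y := ⟪e, r⟫) (.inl hr)]
    congr 2
    ext θ
    simp only [T, c, Set.mem_preimage, Set.mem_ofPred_eq, inner_add_left, real_inner_smul_left]
  have h1 := Measure.prod_apply (μ := volume.restrict (Set.Ioc 0 Real.pi)) (ν := σ) hT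
  rw [Measure.prod_apply_symm hT, lintegral_congr_ae hfib] at h1
  simp only [hrot, lintegral_const, measure_univ, mul_one, Measure.restrict_apply_univ,
    Real.volume_Ioc, sub_zero] at h1
  rw [ENNReal.ofReal_div_of_pos Real.pi_pos, h1,
    ENNReal.mul_div_cancel_right (by simpa using Real.pi_pos) ENNReal.ofReal_ne_top]

end InvariantMeasure

lemma gwSgn_ne_gwSgn_iff_mul_neg {s t : ℝ} (hs : s ≠ 0) (ht : t ≠ 0) :
    gwSgn s ≠ gwSgn t ↔ s * t < 0 := by
  rcases hs.lt_or_gt with hs | hs <;> rcases ht.lt_or_gt with ht | ht <;>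
    simp [gwSgn, mul_neg_iff, hs, ht, hs.le, ht.le, hs.not_ge, ht.not_ge, hs.not_gt, ht.not_gt]
  all_goals norm_num

/-- Goemans–Williamson random-hyperplane lemma: for the uniform (rotation-invariant,
normalized) probability measure `σ` on the unit sphere of `ℝ^n` (here encoded as a
probability measure on `ℝ^n` that is supported on the unit sphere and invariant under
every linear isometry), and unit vectors `u, v`, the probability that a random `r`
separates `u` and `v` is `arccos(⟨u,v⟩)/π`. -/
theorem gw_hyperplane_prob (n : ℕ) (hn : 2 ≤ n)
    (σ : Measure (EuclideanSpace ℝ (Fin n))) (hσprob : IsProbabilityMeasure σ)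
    (hσsupp : σ (Metric.sphere (0 : EuclideanSpace ℝ (Fin n)) 1)ᶜ = 0)
    (hσinv : ∀ O : EuclideanSpace ℝ (Fin n) ≃ₗᵢ[ℝ] EuclideanSpace ℝ (Fin n),
      σ.map O = σ)
    (u v : EuclideanSpace ℝ (Fin n)) (hu : ‖u‖ = 1) (hv : ‖v‖ = 1) :
    σ {r | gwSgn ⟪u, r⟫ ≠ gwSgn ⟪v, r⟫}
      = ENNReal.ofReal (Real.arccos ⟪u, v⟫ / Real.pi) := by
  have h0 : σ {0} = 0 := measure_mono_null (by simp) hσsupp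
  have hne : ∀ w : EuclideanSpace ℝ (Fin n), ‖w‖ = 1 → ∀ᵐ r ∂σ, ⟪w, r⟫ ≠ 0 := by
    intro w hw
    rw [ae_iff]
    simpa using measure_hyperplane_eq_zero hn h0 hσinv hw
  rw [← measure_inner_mul_inner_neg hn h0 hσinv hu hv]
  refine measure_congr ?_
  filter_upwards [hne u hu, hne v hv] with r hur hvr
  exact propext (gwSgn_ne_gwSgn_iff_mul_neg hur hvr)
end

section
/- For all unit vectors u, v, w in ℝ^n, 1 − (1/(2π))·(arccos(⟨u,v⟩) + arccos(⟨u,w⟩) + arccos(⟨v,w⟩)) ≥ (0.796/4)·(1 + ⟨u,v⟩ + ⟨u,w⟩ + ⟨v,w⟩). -/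
open RealInnerProductSpace

open Real in
theorem four_tenths_mul_sq_le_one_sub_cos {t : ℝ} (ht : |t| ≤ 1.3) : 0.4 * t ^ 2 ≤ 1 - cos t := by
  wlog h0 : 0 ≤ t generalizing t
  · simpa using this (t := -t) (by simpa using ht) (by linarith)
  rw [abs_of_nonneg h0] at ht
  have hs := Real.sin_ge_sub_cube (x := t / 2) (by linarith)
  have hc : 1 - cos t = 2 * sin (t / 2) ^ 2 := by
    rw [sin_sq_eq_half_sub]
    ring_nf
  have hs' : 0.46 * t ≤ sin (t / 2) := by
    have : t * t ^ 2 ≤ t * 1.3 ^ 2 := by gcongr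
    linarith
  rw [hc]
  nlinarith [pow_le_pow_left₀ (by positivity) hs' 2]

/-- The seventh order Taylor polynomial is a lower bound for `arctan`. -/
theorem taylor_le_arctan {x : ℝ} (hx : 0 ≤ x) :
    x - x ^ 3 / 3 + x ^ 5 / 5 - x ^ 7 / 7 ≤ Real.arctan x := by
  have hd : ∀ y : ℝ, HasDerivAt
      (fun y => Real.arctan y - (y - y ^ 3 / 3 + y ^ 5 / 5 - y ^ 7 / 7)) (y ^ 8 / (1 + y ^ 2)) y := by
    intro y
    have h := (Real.hasDerivAt_arctan y).sub (((((hasDerivAt_id y).sub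
      ((hasDerivAt_pow 3 y).div_const 3)).add ((hasDerivAt_pow 5 y).div_const 5)).sub
      ((hasDerivAt_pow 7 y).div_const 7)))
    refine h.congr_deriv ?_
    have : 1 + y ^ 2 ≠ 0 := by positivity
    field_simp
    norm_num
    ring
  have hm := monotone_of_hasDerivAt_nonneg hd (fun y => by positivity)
  have := hm hx
  norm_num at this
  linarith

open Real in
/-- The tangent-type bound `x + 2πk cos x ≤ 2π(1 - k)/3` with `k = 0.199`, almost sharp at
`x = arcsin 0.8`. -/
theorem add_mul_cos_le {x : ℝ} (h0 : 0 ≤ x) (h1 : x ≤ 2.2) :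
    x + 0.398 * π * cos x ≤ 0.534 * π := by
  have hπ := Real.pi_gt_d6
  have hπ' := Real.pi_lt_d6
  obtain ⟨z, hz⟩ : ∃ z, z = arctan (1 / 3) := ⟨_, rfl⟩
  have hzl : 0.32174 ≤ z := by
    have := taylor_le_arctan (x := 1 / 3) (by norm_num)
    rw [hz]
    norm_num at this ⊢
    linarith
  have hzu : z ≤ 1 / 3 := by
    have := lt_tan (by linarith) (hz ▸ arctan_lt_pi_div_two _)
    rw [hz, tan_arctan, ← hz] at this
    exact this.le
  have hcz : cos z ^ 2 = 9 / 10 := by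
    rw [hz, cos_sq_arctan]
    norm_num
  have hc2 : cos (2 * z) = 0.8 := by
    rw [cos_two_mul, hcz]
    norm_num
  have hs2 : sin (2 * z) = 0.6 := by
    have h : tan z * cos z = sin z := tan_mul_cos (by intro h; norm_num [h] at hcz)
    rw [hz, tan_arctan, ← hz] at h
    rw [sin_two_mul, ← h]
    linarith
  obtain ⟨t, rfl⟩ : ∃ t, x = π / 2 - (2 * z - t) := ⟨x - π / 2 + 2 * z, by ring⟩
  rw [cos_pi_div_two_sub, sin_sub, hc2, hs2]
  have hcos := four_tenths_mul_sq_le_one_sub_cos (t := t)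
    (abs_le.2 ⟨by norm_num at *; linarith, by norm_num at *; linarith⟩)
  have hcos' : 0.75 * (0.4 * t ^ 2) ≤ 0.2388 * π * (1 - cos t) :=
    mul_le_mul (by linarith) hcos (by positivity) (by positivity)
  suffices t - 0.3184 * π * sin t - 0.75 * (0.4 * t ^ 2) ≤ 0.00005 by linarith
  rcases le_total 0 t with ht | ht
  · have hs := Real.sin_ge_sub_cube ht
    have ht' : t ≤ 1.3 := by linarith
    have hs0 : 0 ≤ sin t := sin_nonneg_of_nonneg_of_le_pi ht (by linarith)
    have : 1 * sin t ≤ 0.3184 * π * sin t := by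
      gcongr
      linarith
    have : t ^ 2 * t ≤ t ^ 2 * 1.3 := by gcongr
    linarith [sq_nonneg t]
  · have hs : t ≤ sin t := Real.le_sin ht
    have : 0.3184 * π * t ≤ 0.3184 * π * sin t := by gcongr
    have : 0.3184 * π * -t ≤ 1.0003 * -t := by
      gcongr
      · linarith
      · linarith
    nlinarith [sq_nonneg (t + 0.001)]

open Real in
/-- The inequality for the angles of a triple of unit vectors, one of which is obtuse enough. -/
theorem add_mul_cos_add_cos_add_cos_le {a b c : ℝ} (hc : 2.2 ≤ c) (hcπ : c ≤ π)
    (h1 : c ≤ a + b) (h2 : a ≤ b + c) (h3 : b ≤ a + c) (h4 : a + b + c ≤ 2 * π) :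
    a + b + c + 0.398 * π * (1 + cos a + cos b + cos c) ≤ 2 * π := by
  have hπ := Real.pi_gt_d6
  have hπ' := Real.pi_lt_d6
  obtain ⟨p, rfl⟩ : ∃ p, c = π - 2 * p := ⟨(π - c) / 2, by ring⟩
  obtain ⟨q, d, rfl, rfl⟩ : ∃ q d, a = π / 2 + q + d ∧ b = π / 2 + q - d :=
    ⟨(a + b - π) / 2, (a - b) / 2, by ring, by ring⟩
  have hd : sin p ≤ cos d := by
    rw [← cos_pi_div_two_sub, ← cos_abs d]
    exact cos_le_cos_of_nonneg_of_le_pi (abs_nonneg d) (by linarith)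
      (abs_le.2 ⟨by linarith, by linarith⟩)
  have hab : cos (π / 2 + q + d) + cos (π / 2 + q - d) = -2 * sin q * cos d := by
    rw [cos_add, cos_sub, add_comm (π / 2) q, cos_add_pi_div_two]
    ring
  have hcp : cos (π - 2 * p) = 2 * sin p ^ 2 - 1 := by
    rw [cos_pi_sub, cos_two_mul, cos_sq']
    ring
  have hp0 : 0 ≤ p := by linarith
  have hsp : sin p ≤ p := sin_le hp0
  have hsp0 : 0 ≤ sin p := sin_nonneg_of_nonneg_of_le_pi hp0 (by linarith)
  suffices 0.398 * π * (sin p ^ 2 - sin q * cos d) ≤ p - q by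
    have e : 1 + cos (π / 2 + q + d) + cos (π / 2 + q - d) + cos (π - 2 * p)
      = 2 * (sin p ^ 2 - sin q * cos d) := by linarith
    rw [e]
    linarith
  suffices ∃ s, sin p ^ 2 - sin q * cos d ≤ s ∧ 0 ≤ s ∧ 1.2504 * s ≤ p - q by
    obtain ⟨s, hs, hs0, hs'⟩ := this
    calc _ ≤ 0.398 * π * s := by gcongr
      _ ≤ 1.2504 * s := by gcongr; linarith
      _ ≤ _ := hs'
  rcases le_total 0 q with hq | hq
  · have hsq0 : 0 ≤ sin q := sin_nonneg_of_nonneg_of_le_pi hq (by linarith)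
    have hsub : sin p - sin q ≤ p - q := by
      have h := Real.abs_sin_sub_sin_le p q
      rw [abs_of_nonneg (a := p - q) (by linarith)] at h
      exact (le_abs_self _).trans h
    refine ⟨1 / 2 * (p - q), ?_, by linarith, by linarith⟩
    calc sin p ^ 2 - sin q * cos d ≤ sin p * (sin p - sin q) := by nlinarith
      _ ≤ sin p * (p - q) := by gcongr
      _ ≤ 1 / 2 * (p - q) := by
        gcongr
        · linarith
        · linarith
  · have hsq : q ≤ sin q := Real.le_sin hq
    have hsq0 : sin q ≤ 0 := sin_nonpos_of_nonpos_of_neg_pi_le hq (by linarith)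
    have hp2 : sin p ^ 2 ≤ p ^ 2 := by gcongr
    refine ⟨p ^ 2 - q, by nlinarith [cos_le_one d], by nlinarith, by nlinarith⟩

/-- For all unit vectors `u, v, w` in `ℝ^n`,
`1 - (1/(2π))(arccos⟨u,v⟩ + arccos⟨u,w⟩ + arccos⟨v,w⟩)
  ≥ (0.796/4)(1 + ⟨u,v⟩ + ⟨u,w⟩ + ⟨v,w⟩)`. -/
theorem gw_dicut_ratio (n : ℕ) (u v w : EuclideanSpace ℝ (Fin n))
    (hu : ‖u‖ = 1) (hv : ‖v‖ = 1) (hw : ‖w‖ = 1) :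
    1 - (1 / (2 * Real.pi)) *
        (Real.arccos ⟪u, v⟫ + Real.arccos ⟪u, w⟫ + Real.arccos ⟪v, w⟫)
      ≥ (0.796 / 4) * (1 + ⟪u, v⟫ + ⟪u, w⟫ + ⟪v, w⟫) := by
  have hπ := Real.pi_pos
  have harc : ∀ x y : EuclideanSpace ℝ (Fin n), ‖x‖ = 1 → ‖y‖ = 1 →
      InnerProductGeometry.angle x y = Real.arccos ⟪x, y⟫ ∧
        Real.cos (InnerProductGeometry.angle x y) = ⟪x, y⟫ := by
    intro x y hx hy
    exact ⟨by simp [InnerProductGeometry.angle, hx, hy],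
      (InnerProductGeometry.inner_eq_cos_angle_of_norm_eq_one hx hy).symm⟩
  obtain ⟨ha, ha'⟩ := harc u v hu hv
  obtain ⟨hb, hb'⟩ := harc u w hu hw
  obtain ⟨hc, hc'⟩ := harc v w hv hw
  rw [← ha, ← hb, ← hc, ← ha', ← hb', ← hc']
  have h1 := InnerProductGeometry.angle_le_angle_add_angle u v w
  have h2 := InnerProductGeometry.angle_le_angle_add_angle u w v
  have h3 := InnerProductGeometry.angle_le_angle_add_angle v u w
  have h4 := InnerProductGeometry.angle_le_angle_add_angle u (-w) v
  rw [InnerProductGeometry.angle_neg_right, InnerProductGeometry.angle_neg_left,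
    InnerProductGeometry.angle_comm w v] at h4
  rw [InnerProductGeometry.angle_comm w v] at h2
  rw [InnerProductGeometry.angle_comm v u] at h3
  have ha0 := InnerProductGeometry.angle_nonneg u v
  have hb0 := InnerProductGeometry.angle_nonneg u w
  have hc0 := InnerProductGeometry.angle_nonneg v w
  have haπ := InnerProductGeometry.angle_le_pi u v
  have hbπ := InnerProductGeometry.angle_le_pi u w
  have hcπ := InnerProductGeometry.angle_le_pi v w
  generalize InnerProductGeometry.angle u v = a at *
  generalize InnerProductGeometry.angle u w = b at *
  generalize InnerProductGeometry.angle v w = c at *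
  suffices h : a + b + c + 0.398 * Real.pi *
      (1 + Real.cos a + Real.cos b + Real.cos c) ≤ 2 * Real.pi by
    rw [ge_iff_le, ← sub_nonneg]
    have e : 1 - 1 / (2 * Real.pi) * (a + b + c) -
        0.796 / 4 * (1 + Real.cos a + Real.cos b + Real.cos c) =
        (2 * Real.pi - (a + b + c + 0.398 * Real.pi *
          (1 + Real.cos a + Real.cos b + Real.cos c))) / (2 * Real.pi) := by
      field_simp
      ring
    rw [e]
    exact div_nonneg (by linarith) (by linarith)
  by_cases hc2 : 2.2 ≤ c
  · exact add_mul_cos_add_cos_add_cos_le hc2 hcπ (by linarith) (by linarith) (by linarith)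
      (by linarith)
  by_cases hb2 : 2.2 ≤ b
  · linarith [add_mul_cos_add_cos_add_cos_le (a := a) (b := c) hb2 hbπ (by linarith)
      (by linarith) (by linarith) (by linarith)]
  by_cases ha2 : 2.2 ≤ a
  · linarith [add_mul_cos_add_cos_add_cos_le (a := b) (b := c) ha2 haπ (by linarith)
      (by linarith) (by linarith) (by linarith)]
  linarith [add_mul_cos_le ha0 (le_of_not_ge ha2), add_mul_cos_le hb0 (le_of_not_ge hb2),
    add_mul_cos_le hc0 (le_of_not_ge hc2)]
end

section
/- Let A be an n×n real symmetric positive semidefinite matrix and let u_1,…,u_n be unit vectors in ℝ^n. Then there exists z ∈ {−1,1}^n such that Σ_{i,j} A_{ij}·z_i·z_j ≥ (2/π)·Σ_{i,j} A_{ij}·⟨u_i,u_j⟩. -/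
open Finset RealInnerProductSpace
open MeasureTheory ProbabilityTheory

theorem integral_abs_gaussianReal : ∫ x, |x| ∂gaussianReal 0 1 = √(2 / Real.pi) := by
  have h := integral_rpow_mul_exp_neg_mul_rpow (p := 2) (q := 1) (b := 1 / 2)
    (by norm_num) (by norm_num) (by norm_num)
  have hexp_integral : ∫ x : ℝ, |x| * Real.exp (-(1 / 2) * |x| ^ 2) = 2 := by
    rw [integral_comp_abs (f := fun x => x * Real.exp (-(1 / 2) * x ^ 2))]
    norm_num [Real.rpow_neg_one] at h ⊢
    linarith
  have hdensity : ∫ x, |x| ∂gaussianReal 0 1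
      = (√(2 * Real.pi))⁻¹ * ∫ x : ℝ, |x| * Real.exp (-(1 / 2) * |x| ^ 2) := by
    rw [integral_gaussianReal_eq_integral_smul one_ne_zero, ← integral_const_mul]
    refine integral_congr_ae (.of_forall fun x => ?_)
    simp only [gaussianPDFReal, smul_eq_mul, sq_abs]
    norm_num
    ring_nf
  rw [hdensity, hexp_integral, Real.sqrt_mul (by norm_num), Real.sqrt_div (by norm_num)]
  have := Real.mul_self_sqrt (show (0:ℝ) ≤ 2 by norm_num)
  field_simp
  linarith

/-- The sign of a real number, with the value `1` at `0`. -/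
noncomputable def unitSign (t : ℝ) : ℝ := if 0 ≤ t then 1 else -1

theorem unitSign_eq_one_or (t : ℝ) : unitSign t = 1 ∨ unitSign t = -1 := by
  unfold unitSign; split_ifs <;> simp

theorem unitSign_mul_self (t : ℝ) : unitSign t * t = |t| := by
  unfold unitSign
  split_ifs with h
  · rw [abs_of_nonneg h, one_mul]
  · rw [abs_of_neg (not_le.mp h), neg_one_mul]

theorem measurable_unitSign : Measurable unitSign :=
  Measurable.ite measurableSet_Ici measurable_const measurable_const

section StdGaussian

variable {E : Type*} [NormedAddCommGroup E] [InnerProductSpace ℝ E] [FiniteDimensional ℝ E]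
  [MeasurableSpace E] [BorelSpace E]

theorem map_inner_stdGaussian {u : E} (hu : ‖u‖ = 1) :
    (stdGaussian E).map (fun g => ⟪u, g⟫) = gaussianReal 0 1 := by
  have := IsGaussian.map_eq_gaussianReal (μ := stdGaussian E) (innerSL ℝ u)
  rw [integral_strongDual_stdGaussian, variance_dual_stdGaussian, innerSL_apply_norm, hu] at this
  simpa using this

theorem memLp_inner_stdGaussian (u : E) : MemLp (fun g => ⟪u, g⟫) 2 (stdGaussian E) :=
  IsGaussian.memLp_dual (stdGaussian E) (innerSL ℝ u) 2 (by simp)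

theorem integral_inner_mul_inner_stdGaussian (u v : E) :
    ∫ g, ⟪u, g⟫ * ⟪v, g⟫ ∂stdGaussian E = ⟪u, v⟫ := by
  have h := covarianceBilin_apply (μ := stdGaussian E) IsGaussian.memLp_two_id u v
  simpa [covarianceBilin_stdGaussian, integral_id_stdGaussian, innerSL_apply_apply ℝ] using h.symm

theorem integrable_unitSign_inner_mul_inner (u v : E) :
    Integrable (fun g => unitSign ⟪u, g⟫ * ⟪v, g⟫) (stdGaussian E) := by
  refine ((memLp_inner_stdGaussian v).integrable (by norm_num)).bdd_mul (c := 1)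
    (measurable_unitSign.comp (by fun_prop)).aestronglyMeasurable (.of_forall fun g => ?_)
  rcases unitSign_eq_one_or ⟪u, g⟫ with h | h <;> simp [h]

theorem integral_unitSign_inner_mul_inner_of_orthogonal {u w : E} (h : ⟪w, u⟫ = 0) :
    ∫ g, unitSign ⟪u, g⟫ * ⟪w, g⟫ ∂stdGaussian E = 0 := by
  set R := (ℝ ∙ w)ᗮ.reflection
  have hu : R u = u :=
    Submodule.reflection_mem_subspace_eq_self
      (Submodule.mem_orthogonal_singleton_iff_inner_right.mpr h)
  have hw : R w = -w := Submodule.reflection_orthogonalComplement_singleton_eq_neg w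
  have key : ∫ g, unitSign ⟪u, g⟫ * ⟪w, g⟫ ∂stdGaussian E
      = -∫ g, unitSign ⟪u, g⟫ * ⟪w, g⟫ ∂stdGaussian E := by
    conv_lhs => rw [← stdGaussian_map (E := E) R]
    have hR : MeasurableEmbedding R := R.toHomeomorph.measurableEmbedding
    rw [hR.integral_map, ← integral_neg]
    refine integral_congr_ae (.of_forall fun g => ?_)
    have hRu : ⟪u, R g⟫ = ⟪u, g⟫ := by rw [← R.inner_map_map u g, hu]
    have hRw : ⟪w, R g⟫ = -⟪w, g⟫ := by
      rw [← R.inner_map_map w g, hw, inner_neg_left, neg_neg]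
    simp only [hRu, hRw, mul_neg]
  linarith

theorem integral_unitSign_inner_mul_inner {u : E} (hu : ‖u‖ = 1) (v : E) :
    ∫ g, unitSign ⟪u, g⟫ * ⟪v, g⟫ ∂stdGaussian E = √(2 / Real.pi) * ⟪u, v⟫ := by
  have hw : ⟪v - ⟪u, v⟫ • u, u⟫ = 0 := by
    rw [inner_sub_left, real_inner_smul_left, real_inner_self_eq_norm_sq, hu, real_inner_comm]
    ring
  have habs : ∫ g, |⟪u, g⟫| ∂stdGaussian E = √(2 / Real.pi) := by
    rw [← integral_abs_gaussianReal, ← map_inner_stdGaussian hu,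
      integral_map (by fun_prop) (by fun_prop)]
  have hdecomp : ∀ g : E, unitSign ⟪u, g⟫ * ⟪v, g⟫
      = ⟪u, v⟫ * |⟪u, g⟫| + unitSign ⟪u, g⟫ * ⟪v - ⟪u, v⟫ • u, g⟫ := fun g => by
    rw [← unitSign_mul_self, inner_sub_left, real_inner_smul_left]
    ring
  simp_rw [hdecomp]
  rw [integral_add (((memLp_inner_stdGaussian u).integrable (by norm_num)).abs.const_mul _)
    (integrable_unitSign_inner_mul_inner _ _), integral_const_mul, habs,
    integral_unitSign_inner_mul_inner_of_orthogonal hw]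
  ring

end StdGaussian

/-- For a positive semidefinite form `Q`, `2 Q(x, y) - Q(y, y) ≤ Q(x, x)`. -/
theorem Matrix.PosSemidef.two_mul_sum_le {ι : Type*} [Fintype ι] {A : Matrix ι ι ℝ}
    (hA : A.PosSemidef) (x y : ι → ℝ) :
    2 * ∑ i, ∑ j, A i j * (x i * y j) - ∑ i, ∑ j, A i j * (y i * y j)
      ≤ ∑ i, ∑ j, A i j * x i * x j := by
  have h := hA.dotProduct_mulVec_nonneg (x - y)
  have hsymm : ∑ i, ∑ j, A i j * (y i * x j) = ∑ i, ∑ j, A i j * (x i * y j) := by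
    rw [Finset.sum_comm]
    refine Finset.sum_congr rfl fun i _ => Finset.sum_congr rfl fun j _ => ?_
    rw [← hA.isHermitian.apply i j, star_trivial, mul_comm (y j)]
  have hexp : star (x - y) ⬝ᵥ A.mulVec (x - y) = ∑ i, ∑ j, A i j * x i * x j
      - ∑ i, ∑ j, A i j * (x i * y j) - ∑ i, ∑ j, A i j * (y i * x j)
      + ∑ i, ∑ j, A i j * (y i * y j) := by
    simp only [dotProduct, Matrix.mulVec, Finset.mul_sum, ← Finset.sum_sub_distrib,
      ← Finset.sum_add_distrib]
    refine Finset.sum_congr rfl fun i _ => Finset.sum_congr rfl fun j _ => ?_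
    simp only [star_trivial, Pi.sub_apply]
    ring
  linarith

/-- Charikar–Wirth rounding guarantee: for a real symmetric positive semidefinite
matrix `A` and unit vectors `u_1, …, u_n`, there is a sign vector `z ∈ {−1,1}^n` with
`Σ_{i,j} A_{ij} z_i z_j ≥ (2/π) Σ_{i,j} A_{ij} ⟨u_i, u_j⟩`. -/
theorem exists_sign_vector_quadratic (n : ℕ) (A : Matrix (Fin n) (Fin n) ℝ)
    (hA : A.PosSemidef) (u : Fin n → EuclideanSpace ℝ (Fin n)) (hu : ∀ i, ‖u i‖ = 1) :
    ∃ z : Fin n → ℝ, (∀ i, z i = 1 ∨ z i = -1) ∧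
      ∑ i : Fin n, ∑ j : Fin n, A i j * z i * z j
        ≥ (2 / Real.pi) * ∑ i : Fin n, ∑ j : Fin n, A i j * ⟪u i, u j⟫ := by
  set c := √(2 / Real.pi)
  have hc : c * c = 2 / Real.pi := Real.mul_self_sqrt (by positivity)
  let μ := stdGaussian (EuclideanSpace ℝ (Fin n))
  let F : EuclideanSpace ℝ (Fin n) → ℝ := fun g => ∑ i, ∑ j,
    (2 * c * A i j * (unitSign ⟪u i, g⟫ * ⟪u j, g⟫) - c * c * A i j * (⟪u i, g⟫ * ⟪u j, g⟫))
  have hsign : ∀ i j, Integrable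
      (fun g => 2 * c * A i j * (unitSign ⟪u i, g⟫ * ⟪u j, g⟫)) μ := fun i j =>
    (integrable_unitSign_inner_mul_inner _ _).const_mul _
  have hquad : ∀ i j, Integrable (fun g => c * c * A i j * (⟪u i, g⟫ * ⟪u j, g⟫)) μ :=
    fun i j => ((memLp_inner_stdGaussian (u i)).integrable_mul
      (memLp_inner_stdGaussian (u j))).const_mul _
  have hint : ∀ i j, Integrable (fun g => 2 * c * A i j * (unitSign ⟪u i, g⟫ * ⟪u j, g⟫)
      - c * c * A i j * (⟪u i, g⟫ * ⟪u j, g⟫)) μ := fun i j => (hsign i j).sub (hquad i j)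
  have hrow := fun i => integrable_finsetSum univ fun j _ => hint i j
  have hF : Integrable F μ := integrable_finsetSum univ fun i _ => hrow i
  have hFint : ∫ g, F g ∂μ = 2 / Real.pi * ∑ i, ∑ j, A i j * ⟪u i, u j⟫ := by
    rw [integral_finsetSum _ fun i _ => hrow i, Finset.mul_sum]
    refine Finset.sum_congr rfl fun i _ => ?_
    rw [integral_finsetSum _ fun j _ => hint i j, Finset.mul_sum]
    refine Finset.sum_congr rfl fun j _ => ?_
    rw [integral_sub (hsign i j) (hquad i j), integral_const_mul, integral_const_mul,
      integral_unitSign_inner_mul_inner (hu i), integral_inner_mul_inner_stdGaussian,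
      show √(2 / Real.pi) = c from rfl, ← hc]
    ring
  obtain ⟨g, hg⟩ := exists_integral_le hF
  refine ⟨fun i => unitSign ⟪u i, g⟫, fun i => unitSign_eq_one_or _, ?_⟩
  rw [ge_iff_le, ← hFint]
  refine hg.trans (le_trans (le_of_eq ?_)
    (hA.two_mul_sum_le (fun i => unitSign ⟪u i, g⟫) (fun i => c * ⟪u i, g⟫)))
  simp only [F, Finset.mul_sum, ← Finset.sum_sub_distrib]
  refine Finset.sum_congr rfl fun i _ => Finset.sum_congr rfl fun j _ => ?_
  ring
end

section
/- Let k ≥ 2, set p = (1 + √(2/k))/2 and q = 1 − p. Then for every ζ ∈ {−1,1}^k with m = #{i : ζ_i = 1}: p^m·q^{k−m} + q^m·p^{k−m} ≥ (4·0.93945/e)·(k/2^k)·((2m − k)/k)². Equivalently, if X_1,…,X_k are independent random signs with P(X_i = 1) = (1 + √(2/k)·ζ_i)/2, then P(X_1 = X_2 = ⋯ = X_k) ≥ (4·0.93945/e)·(k/2^k)·Z², where Z = (1/k)·Σ_i ζ_i. -/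
open Finset

/-- The minimum of `cosh v / v ^ 2` is at least `0.93945`. -/
lemma mul_sq_le_cosh (v : ℝ) : 0.93945 * v ^ 2 ≤ Real.cosh v := by
  have hsum := sum_le_hasSum (range 7)
    (fun n _ => div_nonneg ((even_two_mul n).pow_nonneg v) (Nat.cast_nonneg _)) (Real.hasSum_cosh v)
  have htan (n : ℕ) : (v ^ 2 / 4.2656) ^ n ≥ 1 + n * (v ^ 2 / 4.2656 - 1) := by
    have h0 : 0 ≤ v ^ 2 / 4.2656 := by positivity
    have := one_add_mul_le_pow (show -2 ≤ v ^ 2 / 4.2656 - 1 by linarith) n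
    simpa using this
  have h2 := htan 2
  have h3 := htan 3
  have h4 := htan 4
  have h5 := htan 5
  have h6 := htan 6
  simp only [sum_range_succ, range_zero, sum_empty, Nat.factorial, pow_mul] at hsum
  have hw := sq_nonneg v
  generalize v ^ 2 = w at *
  norm_num [div_pow] at *
  linarith

/-- A Taylor bound for `log (1 - x)` on `[0, 1/2]`. -/
lemma neg_taylor_le_log_one_sub {x : ℝ} (hx : 0 ≤ x) (hx' : x ≤ 1 / 2) :
    -(x + x ^ 2 / 2 + x ^ 3 / 3 + x ^ 4 / 4 + 2 * x ^ 5 / 5) ≤ Real.log (1 - x) := by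
  let f : ℝ → ℝ := fun t =>
    Real.log (1 - t) + (t + t ^ 2 / 2 + t ^ 3 / 3 + t ^ 4 / 4 + 2 * t ^ 5 / 5)
  have hderiv (t : ℝ) (ht : t < 1) : HasDerivAt f (t ^ 4 * (1 - 2 * t) / (1 - t)) t := by
    have h1 : 1 - t ≠ 0 := by linarith
    have hid := hasDerivAt_id t
    have := ((hid.const_sub 1).log h1).add
      ((((hid.add ((hid.pow 2).div_const 2)).add ((hid.pow 3).div_const 3)).add
        ((hid.pow 4).div_const 4)).add (((hid.pow 5).const_mul 2).div_const 5))
    convert! this using 1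
    simp only [id]
    field_simp
    norm_num
    ring
  have hmono : MonotoneOn f (Set.Icc 0 (1 / 2)) := by
    apply monotoneOn_of_hasDerivWithinAt_nonneg (convex_Icc _ _)
      (f' := fun t => t ^ 4 * (1 - 2 * t) / (1 - t))
    · exact fun t ht => (hderiv t (by linarith [ht.2])).continuousAt.continuousWithinAt
    · intro t ht
      rw [interior_Icc] at ht
      exact (hderiv t (by linarith [ht.2])).hasDerivWithinAt
    · intro t ht
      rw [interior_Icc] at ht
      have h1 : 0 ≤ 1 - 2 * t := by linarith [ht.2]
      have h2 : 0 ≤ 1 - t := by linarith [ht.2, ht.1]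
      positivity
  have h := hmono ⟨le_rfl, by norm_num⟩ ⟨hx, hx'⟩ hx
  simp only [f] at h
  norm_num at h
  linarith

lemma neg_one_le_log_one_sub_div_add {x : ℝ} (hx : 0 < x) (hx' : x ≤ 1 / 2) :
    -1 ≤ Real.log (1 - x) / x + 2 * Real.log (1 + (x / 3 + x ^ 2 / 5)) := by
  have h1 : -(1 + x / 2 + x ^ 2 / 3 + x ^ 3 / 4 + 2 * x ^ 4 / 5) ≤ Real.log (1 - x) / x := by
    rw [le_div_iff₀ hx]
    linarith [neg_taylor_le_log_one_sub hx.le hx']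
  have h2 := Real.le_log_one_add_of_nonneg (x := x / 3 + x ^ 2 / 5) (by positivity)
  have h3 : (x / 2 + x ^ 2 / 3 + x ^ 3 / 4 + 2 * x ^ 4 / 5) / 2
      ≤ 2 * (x / 3 + x ^ 2 / 5) / (x / 3 + x ^ 2 / 5 + 2) := by
    rw [le_div_iff₀ (by positivity)]
    have key : 0 ≤ x * (4 / 3 + 4 * x / 5 -
        (1 / 2 + x / 3 + x ^ 2 / 4 + 2 * x ^ 3 / 5) * (2 + x / 3 + x ^ 2 / 5)) := by
      apply mul_nonneg hx.le
      have c2 : x ^ 2 ≤ x / 2 := by nlinarith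
      have c3 : x ^ 3 ≤ x / 4 := by nlinarith
      have c4 : x ^ 4 ≤ x / 8 := by nlinarith
      have c5 : x ^ 5 ≤ x / 16 := by nlinarith
      linarith
    linarith
  linarith

/-- Comparison of `artanh s = log ((1 + s) / (1 - s)) / 2` with `s`, for `s ^ 2 ≤ 1 / 2`. -/
lemma exp_neg_one_mul_sq_le {s : ℝ} (hs : 0 < s) (hs' : s ^ 2 ≤ 1 / 2) :
    Real.exp (-1) * s ^ 2 ≤ Real.exp (Real.log (1 - s ^ 2) / s ^ 2) *
      (1 / 2 * Real.log ((1 + s) / (1 - s))) ^ 2 := by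
  have hx : 0 < s ^ 2 := by positivity
  have hY : 0 < 1 + (s ^ 2 / 3 + (s ^ 2) ^ 2 / 5) := by positivity
  have hexp := Real.exp_le_exp.mpr (neg_one_le_log_one_sub_div_add hx hs')
  rw [Real.exp_add, two_mul, Real.exp_add, Real.exp_log hY] at hexp
  have hL := Real.sum_range_le_log_div hs.le (show s < 1 by nlinarith) 3
  have hL' : s * (1 + (s ^ 2 / 3 + (s ^ 2) ^ 2 / 5))
      ≤ 1 / 2 * Real.log ((1 + s) / (1 - s)) := by
    refine le_trans (le_of_eq ?_) hL
    norm_num [sum_range_succ]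
    ring
  calc Real.exp (-1) * s ^ 2
      ≤ (Real.exp (Real.log (1 - s ^ 2) / s ^ 2) * ((1 + (s ^ 2 / 3 + (s ^ 2) ^ 2 / 5)) *
          (1 + (s ^ 2 / 3 + (s ^ 2) ^ 2 / 5)))) * s ^ 2 := by gcongr
    _ = Real.exp (Real.log (1 - s ^ 2) / s ^ 2) *
          (s * (1 + (s ^ 2 / 3 + (s ^ 2) ^ 2 / 5))) ^ 2 := by ring
    _ ≤ _ := by gcongr

lemma pow_mul_pow_add_eq_cosh {s : ℝ} (hs : 0 ≤ s) (hs' : s < 1) (m n : ℕ) :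
    (1 + s) ^ m * (1 - s) ^ n + (1 - s) ^ m * (1 + s) ^ n =
      2 * Real.exp ((m + n) / 2 * Real.log (1 - s ^ 2)) *
        Real.cosh ((m - n) * (1 / 2 * Real.log ((1 + s) / (1 - s)))) := by
  have ha : 0 < 1 + s := by linarith
  have hb : 0 < 1 - s := by linarith
  have hpow {a : ℝ} (h : 0 < a) (j : ℕ) : a ^ j = Real.exp (j * Real.log a) := by
    rw [Real.exp_nat_mul, Real.exp_log h]
  rw [show 1 - s ^ 2 = (1 + s) * (1 - s) by ring, Real.log_mul ha.ne' hb.ne',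
    Real.log_div ha.ne' hb.ne', Real.cosh_eq, mul_div_assoc', mul_assoc, mul_add,
    ← Real.exp_add, ← Real.exp_add, hpow ha, hpow hb, hpow ha, hpow hb,
    ← Real.exp_add, ← Real.exp_add]
  ring_nf

/-- The bound for signs with bias `√(2/(m+n))`, scaled by `2 ^ (m + n)`, when `4 ≤ m + n`. -/
lemma scaled_bound_of_four_le {m n : ℕ} {s : ℝ} (hs : 0 < s)
    (hs2 : s ^ 2 = 2 / ((m : ℝ) + n)) (h4 : 4 ≤ m + n) :
    4 * 0.93945 / Real.exp 1 * ((m - n : ℝ) ^ 2 / (m + n)) ≤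
      (1 + s) ^ m * (1 - s) ^ n + (1 - s) ^ m * (1 + s) ^ n := by
  have h4' : (4 : ℝ) ≤ m + n := by exact_mod_cast h4
  have hle : s ^ 2 ≤ 1 / 2 := by
    rw [hs2, div_le_iff₀ (by linarith)]
    linarith
  have hk : ((m : ℝ) + n) / 2 = 1 / s ^ 2 := by
    rw [hs2]
    field_simp
  rw [pow_mul_pow_add_eq_cosh hs.le (by nlinarith), hk, one_div_mul_eq_div]
  set L := 1 / 2 * Real.log ((1 + s) / (1 - s))
  set E := Real.exp (Real.log (1 - s ^ 2) / s ^ 2)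
  have hE : 0 < E := Real.exp_pos _
  calc 4 * 0.93945 / Real.exp 1 * ((m - n : ℝ) ^ 2 / (m + n))
      = 2 * 0.93945 * (m - n : ℝ) ^ 2 * (Real.exp (-1) * s ^ 2) := by
        rw [hs2, Real.exp_neg]
        ring
    _ ≤ 2 * 0.93945 * (m - n : ℝ) ^ 2 * (E * L ^ 2) := by
        exact mul_le_mul_of_nonneg_left (exp_neg_one_mul_sq_le hs hle) (by positivity)
    _ = 2 * E * (0.93945 * ((m - n) * L) ^ 2) := by ring
    _ ≤ _ := by
        gcongr
        exact mul_sq_le_cosh _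

lemma scaled_bound {m n : ℕ} {s : ℝ} (hs : 0 < s)
    (hs2 : s ^ 2 = 2 / ((m : ℝ) + n)) (h2 : 2 ≤ m + n) :
    4 * 0.93945 / Real.exp 1 * ((m - n : ℝ) ^ 2 / (m + n)) ≤
      (1 + s) ^ m * (1 - s) ^ n + (1 - s) ^ m * (1 + s) ^ n := by
  rcases le_or_gt 4 (m + n) with h4 | h4
  · exact scaled_bound_of_four_le hs hs2 h4
  have hC : 4 * 0.93945 / Real.exp 1 ≤ 1.4 := by
    rw [div_le_iff₀ (Real.exp_pos 1)]
    linarith [Real.exp_one_gt_d9]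
  refine (mul_le_mul_of_nonneg_right hC (by positivity)).trans ?_
  have hm : m < 4 := by lia
  have hn : n < 4 := by lia
  interval_cases m <;> interval_cases n <;> first | (exfalso; lia) | skip
  all_goals
    push_cast at hs2
    norm_num
    nlinarith

/-- Charikar–Wirth probability bound: for `k ≥ 2`, `p = (1 + √(2/k))/2`, `q = 1 - p`,
and any `ζ ∈ {−1,1}^k` with `m = #{i : ζ_i = 1}`,
`p^m q^{k−m} + q^m p^{k−m} ≥ (4·0.93945/e)·(k/2^k)·((2m − k)/k)²`
(the left side being the probability that `k` independent signs, the `i`-th equal to `1`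
with probability `(1 + √(2/k) ζ_i)/2`, are all equal). -/
theorem charikar_wirth_prob_bound (k : ℕ) (hk : 2 ≤ k)
    (p q : ℝ) (hp : p = (1 + Real.sqrt (2 / (k : ℝ))) / 2) (hq : q = 1 - p)
    (ζ : Fin k → ℝ) (hζ : ∀ i, ζ i = 1 ∨ ζ i = -1)
    (m : ℕ) (hm : m = (Finset.univ.filter (fun i => ζ i = 1)).card) :
    p ^ m * q ^ (k - m) + q ^ m * p ^ (k - m)
      ≥ (4 * 0.93945 / Real.exp 1) * ((k : ℝ) / 2 ^ k) *
          ((2 * (m : ℝ) - (k : ℝ)) / (k : ℝ)) ^ 2 := by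
  have hk0 : (0 : ℝ) < k := by positivity
  have hmk : m ≤ k := by
    rw [hm]
    simpa using card_filter_le (univ : Finset (Fin k)) (fun i => ζ i = 1)
  obtain ⟨n, rfl⟩ := Nat.exists_eq_add_of_le hmk
  push_cast at *
  set s := √(2 / ((m : ℝ) + n))
  have h := scaled_bound (m := m) (n := n) (s := s) (by positivity)
    (Real.sq_sqrt (by positivity)) hk
  have hq' : q = (1 - s) / 2 := by
    rw [hq, hp]
    ring
  rw [Nat.add_sub_cancel_left, hp, hq']
  simp only [div_pow]
  rw [ge_iff_le]
  calc _ = 4 * 0.93945 / Real.exp 1 * ((m - n : ℝ) ^ 2 / (m + n)) / 2 ^ (m + n) := by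
        field_simp
        ring
    _ ≤ _ := div_le_div_of_nonneg_right h (by positivity)
    _ = _ := by
        field_simp
        ring
end
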